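/- Define the polynomial g(x,y) = 23461560*x^2*y^2 + 1221025 + 186624*x^8 - 2984040*y^4*x^2 - 5015520*y^2*x^4 - 284472*y^6 + 384912*y^4*x^4 - 43658160*x^2 + 518400*x^6 + 466560*x^6*y^2 + 116640*y^6*x^2 + 11664*y^8 - 2228394*y^2 - 10769184*x^4 + 1344177*y^4. Then the set of real points (x,y) with g(x,y) = 0, ∂g/∂x(x,y) = 0 and ∂g/∂y(x,y) = 0 is exactly the six-element set consisting of (0, sqrt(51)/6), (0, -sqrt(51)/6), and the four points (±sqrt(525 + 324*6^(2/3) - 864*6^(1/3))/18, ±2*sqrt(231 - 81*6^(2/3) + 54*6^(1/3))/9) with all four sign combinations. (In particular, 525 + 324*6^(2/3) - 864*6^(1/3) ≥ 0 and 231 - 81*6^(2/3) + 54*6^(1/3) ≥ 0, where 6^(1/3) denotes the real cube root of 6.) -/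

import Mathlib

/-- The polynomial defining the parallel lines at offset r = 4/3 to the ellipse
y^2/9 + x^2/(9/4) = 1. -/
noncomputable def g17 (x y : ℝ) : ℝ :=
  23461560*x^2*y^2 + 1221025 + 186624*x^8 - 2984040*y^4*x^2 - 5015520*y^2*x^4 - 284472*y^6 +
    384912*y^4*x^4 - 43658160*x^2 + 518400*x^6 + 466560*x^6*y^2 + 116640*y^6*x^2 + 11664*y^8 -
    2228394*y^2 - 10769184*x^4 + 1344177*y^4

lemma g17_eq (x y p q : ℝ) (hp : p = 469/36 - x^2 - y^2) (hq : q = 161/4 - 9*x^2 - 9/4*y^2) :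
    g17 x y = 2304 * (p^2*q^2 - 4*q^3 - 144*p^3 + 648*p*q - 34992) := by
  subst hp hq; unfold g17; ring

lemma g17_dx (x y p q : ℝ) (hp : p = 469/36 - x^2 - y^2) (hq : q = 161/4 - 9*x^2 - 9/4*y^2) :
    deriv (fun t : ℝ => g17 t y) x = -4608 * x * ((2*p*q^2 - 432*p^2 + 648*q) +
      9 * (2*p^2*q - 12*q^2 + 648*p)) := by
  have h : (fun t : ℝ => g17 t y) = fun t => 186624*t^8 + (518400 + 466560*y^2)*t^6 +
      (- 5015520*y^2 + 384912*y^4 - 10769184)*t^4 +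
      (23461560*y^2 - 2984040*y^4 - 43658160 + 116640*y^6)*t^2 +
      (1221025 - 284472*y^6 + 11664*y^8 - 2228394*y^2 + 1344177*y^4) := by
    funext t; unfold g17; ring
  rw [h]
  have hd := (((((hasDerivAt_pow 8 x).const_mul 186624).add
    ((hasDerivAt_pow 6 x).const_mul (518400 + 466560*y^2))).add
    ((hasDerivAt_pow 4 x).const_mul (- 5015520*y^2 + 384912*y^4 - 10769184))).add
    ((hasDerivAt_pow 2 x).const_mul (23461560*y^2 - 2984040*y^4 - 43658160 + 116640*y^6))).add_const
      (1221025 - 284472*y^6 + 11664*y^8 - 2228394*y^2 + 1344177*y^4)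
  refine hd.deriv.trans ?_
  subst hp hq; push_cast; ring

lemma g17_dy (x y p q : ℝ) (hp : p = 469/36 - x^2 - y^2) (hq : q = 161/4 - 9*x^2 - 9/4*y^2) :
    deriv (fun t : ℝ => g17 x t) y = -4608 * y * ((2*p*q^2 - 432*p^2 + 648*q) +
      9/4 * (2*p^2*q - 12*q^2 + 648*p)) := by
  have h : (fun t : ℝ => g17 x t) = fun t => 11664*t^8 + (116640*x^2 - 284472)*t^6 +
      (- 2984040*x^2 + 384912*x^4 + 1344177)*t^4 +
      (23461560*x^2 - 5015520*x^4 + 466560*x^6 - 2228394)*t^2 +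
      (1221025 + 186624*x^8 - 43658160*x^2 + 518400*x^6 - 10769184*x^4) := by
    funext t; unfold g17; ring
  rw [h]
  have hd := (((((hasDerivAt_pow 8 y).const_mul 11664).add
    ((hasDerivAt_pow 6 y).const_mul (116640*x^2 - 284472))).add
    ((hasDerivAt_pow 4 y).const_mul (- 2984040*x^2 + 384912*x^4 + 1344177))).add
    ((hasDerivAt_pow 2 y).const_mul (23461560*x^2 - 5015520*x^4 + 466560*x^6 - 2228394))).add_const
      (1221025 + 186624*x^8 - 43658160*x^2 + 518400*x^6 - 10769184*x^4)
  refine hd.deriv.trans ?_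
  subst hp hq; push_cast; ring

/-- The singular points of the discriminant of `t^3 + p t^2 + q t + 36`. -/
lemma cusp (p q m : ℝ) (hm : m^3 = 36) (h0 : p^2*q^2 - 4*q^3 - 144*p^3 + 648*p*q - 34992 = 0)
    (h1 : 2*p*q^2 - 432*p^2 + 648*q = 0) (h2 : 2*p^2*q - 12*q^2 + 648*p = 0) :
    p = 3*m ∧ q = 3*m^2 := by
  have h3 : q^3 = (m*p)^3 := by
    linear_combination (1/12)*p*h1 - (1/12)*q*h2 - p^3*hm
  have h4 : q = m*p := (Odd.strictMono_pow (by decide : Odd 3)).injective h3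
  subst h4
  have hm0 : m ≠ 0 := by rintro rfl; norm_num at hm
  have hp0 : p ≠ 0 := by rintro rfl; norm_num at h0
  have h5 : 2*p*m*(p-3*m)^2 = 0 := by linear_combination h2 + 18*p*hm
  have h6 : p = 3*m := by
    have : (p-3*m)^2 = 0 := by
      rcases mul_eq_zero.1 h5 with h | h
      · exact absurd h (by positivity)
      · exact h
    have := pow_eq_zero_iff (two_ne_zero) |>.1 this
    linarith
  exact ⟨h6, by rw [h6]; ring⟩

theorem ellipse_supercritical_six_singular_points :
    0 ≤ 525 + 324*(6:ℝ)^((2:ℝ)/3) - 864*(6:ℝ)^((1:ℝ)/3) ∧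
    0 ≤ 231 - 81*(6:ℝ)^((2:ℝ)/3) + 54*(6:ℝ)^((1:ℝ)/3) ∧
    {q : ℝ × ℝ | g17 q.1 q.2 = 0 ∧
        deriv (fun t : ℝ => g17 t q.2) q.1 = 0 ∧
        deriv (fun t : ℝ => g17 q.1 t) q.2 = 0}
      = {((0 : ℝ), Real.sqrt 51 / 6), ((0 : ℝ), -(Real.sqrt 51 / 6)),
         (Real.sqrt (525 + 324*(6:ℝ)^((2:ℝ)/3) - 864*(6:ℝ)^((1:ℝ)/3))/18,
          2*Real.sqrt (231 - 81*(6:ℝ)^((2:ℝ)/3) + 54*(6:ℝ)^((1:ℝ)/3))/9),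
         (-(Real.sqrt (525 + 324*(6:ℝ)^((2:ℝ)/3) - 864*(6:ℝ)^((1:ℝ)/3))/18),
          2*Real.sqrt (231 - 81*(6:ℝ)^((2:ℝ)/3) + 54*(6:ℝ)^((1:ℝ)/3))/9),
         (Real.sqrt (525 + 324*(6:ℝ)^((2:ℝ)/3) - 864*(6:ℝ)^((1:ℝ)/3))/18,
          -(2*Real.sqrt (231 - 81*(6:ℝ)^((2:ℝ)/3) + 54*(6:ℝ)^((1:ℝ)/3))/9)),
         (-(Real.sqrt (525 + 324*(6:ℝ)^((2:ℝ)/3) - 864*(6:ℝ)^((1:ℝ)/3))/18),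
          -(2*Real.sqrt (231 - 81*(6:ℝ)^((2:ℝ)/3) + 54*(6:ℝ)^((1:ℝ)/3))/9))} := by
  have hs3 : ((6:ℝ)^((1:ℝ)/3))^3 = 6 := by
    rw [← Real.rpow_natCast, ← Real.rpow_mul (by norm_num)]; norm_num
  have hs2 : (6:ℝ)^((2:ℝ)/3) = ((6:ℝ)^((1:ℝ)/3))^2 := by
    rw [← Real.rpow_natCast, ← Real.rpow_mul (by norm_num)]; norm_num
  have hs0 : 0 < (6:ℝ)^((1:ℝ)/3) := by positivity
  rw [hs2]
  generalize (6:ℝ)^((1:ℝ)/3) = s at *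
  have hl : 1.8 ≤ s := by
    by_contra h
    push Not at h
    have := pow_lt_pow_left₀ h hs0.le (three_ne_zero)
    norm_num at this; linarith
  have hu : s ≤ 1.9 := by
    by_contra h
    push Not at h
    have := pow_lt_pow_left₀ h (by norm_num) (three_ne_zero)
    norm_num at this; linarith
  have hR1 : 0 ≤ 525 + 324*s^2 - 864*s := by nlinarith
  have hR2 : 0 ≤ 231 - 81*s^2 + 54*s := by nlinarith
  refine ⟨hR1, hR2, ?_⟩
  generalize hr1 : 525 + 324*s^2 - 864*s = r1 at *
  generalize hr2 : 231 - 81*s^2 + 54*s = r2 at *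
  have hm : (s^2)^3 = 36 := by linear_combination (s^3 + 6) * hs3
  have good : ∀ x y : ℝ, x^2 = r1/324 → y^2 = 4*r2/81 → g17 x y = 0 ∧
        deriv (fun t : ℝ => g17 t y) x = 0 ∧ deriv (fun t : ℝ => g17 x t) y = 0 := by
    intro x y hx hy
    have hp : 3*s^2 = 469/36 - x^2 - y^2 := by rw [hx, hy, ← hr1, ← hr2]; ring
    have hq : 18*s = 161/4 - 9*x^2 - 9/4*y^2 := by rw [hx, hy, ← hr1, ← hr2]; ring
    rw [g17_eq x y _ _ hp hq, g17_dx x y _ _ hp hq, g17_dy x y _ _ hp hq]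
    have e1 : 2*(3*s^2)*(18*s)^2 - 432*(3*s^2)^2 + 648*(18*s) = 0 := by
      linear_combination (-1944*s) * hs3
    have e2 : 2*(3*s^2)^2*(18*s) - 12*(18*s)^2 + 648*(3*s^2) = 0 := by
      linear_combination (324*s^2) * hs3
    rw [e1, e2]
    refine ⟨?_, by ring, by ring⟩
    linear_combination 2304*(-972*s^3+5832) * hs3
  have good0 : ∀ y : ℝ, y^2 = 17/12 → g17 0 y = 0 ∧
        deriv (fun t : ℝ => g17 t y) 0 = 0 ∧ deriv (fun t : ℝ => g17 0 t) y = 0 := by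
    intro y hy
    rw [g17_eq 0 y _ _ rfl rfl, g17_dx 0 y _ _ rfl rfl, g17_dy 0 y _ _ rfl rfl, hy]
    norm_num
  have q1 : (Real.sqrt r1/18)^2 = r1/324 := by rw [div_pow, Real.sq_sqrt hR1]; norm_num
  have q2 : (2*Real.sqrt r2/9)^2 = 4*r2/81 := by
    rw [div_pow, mul_pow, Real.sq_sqrt hR2]; norm_num
  have q3 : (Real.sqrt 51/6)^2 = 17/12 := by
    rw [div_pow, Real.sq_sqrt (by norm_num)]; norm_num
  ext ⟨x, y⟩
  simp only [Set.mem_setOf_eq, Set.mem_insert_iff, Set.mem_singleton_iff, Prod.mk.injEq]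
  constructor
  · rintro ⟨h0, h1, h2⟩
    rw [g17_dx x y _ _ rfl rfl] at h1
    rw [g17_dy x y _ _ rfl rfl] at h2
    by_cases hx : x = 0
    · subst hx
      have f0 : (9*y^2-169)*((9*y^2-25)*(12*y^2-17)^2) = 0 := by
        rw [← h0]; unfold g17; ring
      have key : y^2 = 17/12 := by
        rcases mul_eq_zero.1 f0 with h | h
        · exfalso
          have e : y^2 = 169/9 := by linarith
          have hy : y ≠ 0 := by rintro rfl; norm_num at e
          rw [e] at h2
          norm_num [hy] at h2
        rcases mul_eq_zero.1 h with h | h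
        · exfalso
          have e : y^2 = 25/9 := by linarith
          have hy : y ≠ 0 := by rintro rfl; norm_num at e
          rw [e] at h2
          norm_num [hy] at h2
        · have := pow_eq_zero_iff (two_ne_zero) |>.1 h
          linarith
      rcases sq_eq_sq_iff_eq_or_eq_neg.1 (key.trans q3.symm) with h | h <;> simp [h]
    · by_cases hy : y = 0
      · exfalso
        subst hy
        have f0 : (36*x^2-289)*((36*x^2-1)*(12*x^2+65)^2) = 0 := by
          rw [← h0]; unfold g17; ring
        rcases mul_eq_zero.1 f0 with h | h
        · have e : x^2 = 289/36 := by linarith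
          rw [e] at h1
          norm_num [hx] at h1
        rcases mul_eq_zero.1 h with h | h
        · have e : x^2 = 1/36 := by linarith
          rw [e] at h1
          norm_num [hx] at h1
        · exact absurd h (by positivity)
      · rw [g17_eq x y _ _ rfl rfl] at h0
        have h1' := (mul_eq_zero.1 h1).resolve_left (by simpa using hx)
        have h2' := (mul_eq_zero.1 h2).resolve_left (by simpa using hy)
        have h0' := (mul_eq_zero.1 h0).resolve_left (by norm_num)
        obtain ⟨c1, c2⟩ := cusp _ _ (s^2) hm h0' (by linarith) (by linarith)
        have c2' : 161/4 - 9*x^2 - 9/4*y^2 = 18*s := by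
          rw [c2]; linear_combination 3*s*hs3
        have hxx : x^2 = (Real.sqrt r1/18)^2 := by rw [q1, ← hr1]; linarith
        have hyy : y^2 = (2*Real.sqrt r2/9)^2 := by rw [q2, ← hr2]; linarith
        rcases sq_eq_sq_iff_eq_or_eq_neg.1 hxx with h | h <;>
        rcases sq_eq_sq_iff_eq_or_eq_neg.1 hyy with h' | h' <;> simp [h, h']
  · rintro (⟨rfl, rfl⟩ | ⟨rfl, rfl⟩ | ⟨rfl, rfl⟩ | ⟨rfl, rfl⟩ | ⟨rfl, rfl⟩ | ⟨rfl, rfl⟩)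
    · exact good0 _ q3
    · exact good0 _ (by rw [neg_sq, q3])
    · exact good _ _ q1 q2
    · exact good _ _ (by rw [neg_sq, q1]) q2
    · exact good _ _ q1 (by rw [neg_sq, q2])
    · exact good _ _ (by rw [neg_sq, q1]) (by rw [neg_sq, q2])
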